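/- arXiv:1907.05781 — 2 statements merged into one kernel-verified Lean document; each statement's English description precedes it below -/
import Mathlib

section
/- Covariance factorization along a unique path. Let K = Σ⁻¹ be adapted to G = (V,E) and let x,y ∈ V be distinct. If π is the unique path between x and y in G (i.e., Π_xy = {π}), then with P = V(π) it holds that σ_xy = σ_{xy·P̄} × IF_P; in particular σ_xy and σ_{xy·P̄} have the same sign and |σ_xy| ≥ |σ_{xy·P̄}|. -/
open Matrix BigOperators Finset

variable {V : Type*} [Fintype V] [DecidableEq V]

/-- Submatrix of `M` with rows indexed by `A` and columns indexed by `B`. -/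
noncomputable def subm (M : Matrix V V ℝ) (A B : Finset V) : Matrix ↥A ↥B ℝ :=
  Matrix.of fun i j => M i.1 j.1

/-- Partial covariance matrix `Σ_{AA·B}` of `A` given a disjoint set `B`. -/
noncomputable def pcovOn (M : Matrix V V ℝ) (A B : Finset V) : Matrix ↥A ↥A ℝ :=
  subm M A A - subm M A B * (subm M B B)⁻¹ * subm M B A

/-- Partial covariance matrix `Σ_{AA·Ā}` given the complement of `A`. -/
noncomputable def pcov (M : Matrix V V ℝ) (A : Finset V) : Matrix ↥A ↥A ℝ :=
  pcovOn M A Aᶜ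

/-- Inflation factor of `A` on `B`. -/
noncomputable def inflF (M : Matrix V V ℝ) (A B : Finset V) : ℝ :=
  ((subm M A A).det * (subm M B B).det) / (subm M (A ∪ B) (A ∪ B)).det

/-- The path weight `ω(π, Γ)` of a walk `p`, computed from `Θ = Γ⁻¹`. -/
noncomputable def pathWeight (Γ : Matrix V V ℝ) {G : SimpleGraph V} {x y : V}
    (p : G.Walk x y) : ℝ :=
  (-1 : ℝ) ^ (p.support.toFinset.card + 1) *
    ((subm Γ⁻¹ p.support.toFinsetᶜ p.support.toFinsetᶜ).det / Γ⁻¹.det) *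
    (p.darts.map fun d => Γ⁻¹ d.toProd.1 d.toProd.2).prod

/-- The partial covariance weight `ω(π, Σ_{AA·Ā})` of a walk `p` with vertices in `A`,
expressed via `K = Σ⁻¹`: `(−1)^{|P|+1} (det K_{A∖P,A∖P}/det K_AA) ∏ κ_uv`. -/
noncomputable def partialPathWeight (S : Matrix V V ℝ) (A : Finset V) {G : SimpleGraph V}
    {x y : V} (p : G.Walk x y) : ℝ :=
  (-1 : ℝ) ^ (p.support.toFinset.card + 1) *
    ((subm S⁻¹ (A \ p.support.toFinset) (A \ p.support.toFinset)).det /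
      (subm S⁻¹ A A).det) *
    (p.darts.map fun d => S⁻¹ d.toProd.1 d.toProd.2).prod

/-- `K` is adapted to `G` when nonzero off-diagonal entries correspond to edges. -/
def Adapted (K : Matrix V V ℝ) (G : SimpleGraph V) : Prop :=
  ∀ u v : V, u ≠ v → K u v ≠ 0 → G.Adj u v

/-- Correlation-type scaling of a positive definite matrix. -/
noncomputable def corrScale {ι : Type*} (M : Matrix ι ι ℝ) : Matrix ι ι ℝ :=
  Matrix.of fun i j => M i j / (Real.sqrt (M i i) * Real.sqrt (M j j))

/-- The inflated correlation matrix `Φ^V = diag(K)^{1/2} Σ diag(K)^{1/2}`. -/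
noncomputable def inflCorr (S : Matrix V V ℝ) : Matrix V V ℝ :=
  Matrix.of fun u v => Real.sqrt (S⁻¹ u u) * S u v * Real.sqrt (S⁻¹ v v)

/-- The weight `ω(π, M)` of a walk `p` whose vertices lie in `P`, computed in the
induced subgraph from a matrix `M` indexed by `P`; here `V(π) = P`, so the determinant
factor (over the empty set) is `1`. -/
noncomputable def subPathWeight {P : Finset V} (M : Matrix ↥P ↥P ℝ) {G : SimpleGraph V}
    {x y : V} (p : G.Walk x y) (hp : ∀ v ∈ p.support, v ∈ P) : ℝ :=
  (-1 : ℝ) ^ (p.support.toFinset.card + 1) * (1 / M⁻¹.det) *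
    (p.darts.attach.map fun d =>
      M⁻¹ ⟨d.1.toProd.1, hp _ (SimpleGraph.Walk.dart_fst_mem_support_of_mem_darts p d.2)⟩
          ⟨d.1.toProd.2, hp _ (SimpleGraph.Walk.dart_snd_mem_support_of_mem_darts p d.2)⟩).prod

/-- Product of partial correlations `ρ_{uv·V∖{u,v}} = −κ_uv/(√κ_uu √κ_vv)`
over the edges of a walk. -/
noncomputable def prodPartialCorr (S : Matrix V V ℝ) {G : SimpleGraph V} {x y : V}
    (p : G.Walk x y) : ℝ :=
  (p.darts.map fun d => -(corrScale S⁻¹ d.toProd.1 d.toProd.2)).prod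

/-- A walk is chordless if every edge of `G` joining two of its vertices is an edge of
the walk. -/
def Chordless {G : SimpleGraph V} {x y : V} (p : G.Walk x y) : Prop :=
  ∀ u v : V, u ∈ p.support → v ∈ p.support → G.Adj u v → s(u, v) ∈ p.edges

/-- The quantity `φ(π, R) = det((I−R)_{P̄P̄}) ∏ ρ_{uv·V∖{u,v}}`. -/
noncomputable def phiWeight (S : Matrix V V ℝ) {G : SimpleGraph V} {x y : V}
    (p : G.Walk x y) : ℝ :=
  (subm (corrScale S⁻¹) p.support.toFinsetᶜ p.support.toFinsetᶜ).det * prodPartialCorr S p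

/-- The equivalence between the disjoint sum of a finset and its complement and the whole
type. -/
def sumComplEquiv {V : Type*} [Fintype V] [DecidableEq V] (P : Finset V) : ↥P ⊕ ↥Pᶜ ≃ V :=
  (Equiv.sumCongr (Equiv.refl _)
    (Equiv.subtypeEquivRight fun i => by simp : {i // i ∈ Pᶜ} ≃ {i // ¬ i ∈ P})).trans
    (Equiv.sumCompl (· ∈ P))

theorem submatrix_sumComplEquiv {V : Type*} [Fintype V] [DecidableEq V] (M : Matrix V V ℝ)
    (P : Finset V) :
    M.submatrix (sumComplEquiv P) (sumComplEquiv P) =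
      Matrix.fromBlocks (subm M P P) (subm M P Pᶜ) (subm M Pᶜ P) (subm M Pᶜ Pᶜ) := by
  ext (i | i) (j | j) <;> rfl

/-- If every permutation with nonzero contribution to `det M` preserves `P`, then `det M`
factors over `P` and its complement. -/
theorem det_eq_mul_of_perm_preserves {V : Type*} [Fintype V] [DecidableEq V]
    (M : Matrix V V ℝ) (P : Finset V)
    (h : ∀ σ : Equiv.Perm V, (∀ i, M (σ i) i ≠ 0) → ∀ i ∈ P, σ i ∈ P) :
    M.det = (subm M P P).det * (subm M Pᶜ Pᶜ).det := by
  set N : Matrix V V ℝ := Matrix.of fun i j => if i ∉ P ∧ j ∈ P then 0 else M i j with hN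
  have hdet : M.det = N.det := by
    rw [Matrix.det_apply, Matrix.det_apply]
    refine Finset.sum_congr rfl fun σ _ => ?_
    congr 1
    by_cases hσ : ∀ i ∈ P, σ i ∈ P
    · refine Finset.prod_congr rfl fun i _ => ?_
      rw [hN, Matrix.of_apply, if_neg]
      exact fun hi => hi.1 (hσ i hi.2)
    · have hM : ¬ ∀ i, M (σ i) i ≠ 0 := fun hne => hσ (h σ hne)
      push Not at hσ hM
      obtain ⟨i, hi, hσi⟩ := hσ
      obtain ⟨j, hj⟩ := hM
      have hNi : N (σ i) i = 0 := by simp [hN, hi, hσi]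
      have hM0 : ∏ i, M (σ i) i = 0 := Finset.prod_eq_zero (Finset.mem_univ j) hj
      have hN0 : ∏ i, N (σ i) i = 0 := Finset.prod_eq_zero (Finset.mem_univ i) hNi
      exact hM0.trans hN0.symm
  have h₁₁ : subm N P P = subm M P P := by
    ext i j
    simp [hN, subm]
  have h₂₁ : subm N Pᶜ P = 0 := by
    ext i j
    simp [hN, subm, Finset.mem_compl.1 i.2]
  have h₂₂ : subm N Pᶜ Pᶜ = subm M Pᶜ Pᶜ := by
    ext i j
    simp [hN, subm, Finset.mem_compl.1 j.2]
  rw [hdet, ← Matrix.det_submatrix_equiv_self (sumComplEquiv P), submatrix_sumComplEquiv, h₂₁,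
    Matrix.det_fromBlocks_zero₂₁, h₁₁, h₂₂]

/-- A function on `ℕ` whose consecutive values are adjacent traces a walk. -/
theorem exists_walk_support_eq_map_range {V : Type*} {G : SimpleGraph V} (f : ℕ → V) (n : ℕ)
    {u v : V} (hu : f 0 = u) (hv : f n = v) (h : ∀ i < n, G.Adj (f i) (f (i + 1))) :
    ∃ w : G.Walk u v, w.support = (List.range (n + 1)).map f := by
  subst hu hv
  induction n with
  | zero => exact ⟨.nil, by simp⟩
  | succ n ih =>
    obtain ⟨w, hw⟩ := ih fun i hi => h i (by omega)
    refine ⟨w.concat (h n n.lt_succ_self), ?_⟩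
    rw [SimpleGraph.Walk.support_concat, hw, List.range_succ (n := n + 1)]
    simp

/-- If `σ x = y` and `σ` moves every point other than `x` along an edge or not at all, then
the orbit of `y` is the vertex set of a path, so `σ` preserves the unique path. -/
theorem perm_mem_support_of_unique_path {V : Type*} [Fintype V] {G : SimpleGraph V}
    {x y : V} {p : G.Walk x y} (huniq : ∀ q : G.Walk x y, q.IsPath → q = p)
    (σ : Equiv.Perm V) (hx : σ x = y) (hσ : ∀ i, i ≠ x → σ i ≠ i → G.Adj (σ i) i)
    {i : V} (hi : i ∈ p.support) : σ i ∈ p.support := by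
  classical
  set m := Function.minimalPeriod σ y with hm
  have hper : y ∈ Function.periodicPts σ :=
    σ.injective.mem_periodicPts y
  have hmpos : 0 < m := Function.minimalPeriod_pos_of_mem_periodicPts hper
  have hmit : σ^[m] y = y := Function.iterate_minimalPeriod
  have hlast : σ^[m - 1] y = x := by
    apply σ.injective
    rw [← Function.iterate_succ_apply' σ, Nat.succ_eq_add_one, Nat.sub_add_cancel hmpos, hmit, hx]
  have hinj : ∀ a < m, ∀ b < m, σ^[a] y = σ^[b] y → a = b := fun a ha b hb hab =>
    (Function.iterate_eq_iterate_iff_of_lt_minimalPeriod ha hb).1 hab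
  have hadj : ∀ j < m - 1, G.Adj (σ^[j] y) (σ^[j + 1] y) := by
    intro j hj
    have h1 : σ^[j] y ≠ x := fun h => by
      have := hinj j (by omega) (m - 1) (by omega) (h.trans hlast.symm)
      omega
    have h2 : σ (σ^[j] y) ≠ σ^[j] y := fun h => by
      rw [← Function.iterate_succ_apply' σ] at h
      have := hinj (j + 1) (by omega) j (by omega) h
      omega
    rw [Function.iterate_succ_apply' σ]
    exact (hσ _ h1 h2).symm
  obtain ⟨w, hw⟩ : ∃ w : G.Walk y x, w.support = _ :=
    exists_walk_support_eq_map_range (fun j => σ^[j] y) (m - 1) rfl hlast hadj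
  rw [Nat.sub_add_cancel hmpos] at hw
  have hwp : w.IsPath := by
    rw [SimpleGraph.Walk.isPath_def, hw]
    refine List.Nodup.map_on (fun a ha b hb hab => ?_) List.nodup_range
    exact hinj a (List.mem_range.1 ha) b (List.mem_range.1 hb) hab
  have hq := huniq w.reverse hwp.reverse
  have hsupp : ∀ v, v ∈ p.support ↔ ∃ j < m, σ^[j] y = v := by
    intro v
    rw [← hq]
    simp [hw, eq_comm]
  obtain ⟨j, -, rfl⟩ := (hsupp i).1 hi
  refine (hsupp _).2 ⟨(j + 1) % m, Nat.mod_lt _ hmpos, ?_⟩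
  rw [Function.iterate_mod_minimalPeriod_eq, Function.iterate_succ_apply' σ]

/-- Along a unique path the adjugate of an adapted matrix factors. -/
theorem adjugate_eq_of_unique_path {V : Type*} [Fintype V] [DecidableEq V]
    (K : Matrix V V ℝ) {G : SimpleGraph V} (hK : Adapted K G) {x y : V}
    (p : G.Walk x y) (huniq : ∀ q : G.Walk x y, q.IsPath → q = p)
    (P : Finset V) (hP : ∀ v, v ∈ P ↔ v ∈ p.support) (hxP : x ∈ P) (hyP : y ∈ P) :
    K.adjugate x y = (subm K P P).adjugate ⟨x, hxP⟩ ⟨y, hyP⟩ * (subm K Pᶜ Pᶜ).det := by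
  rw [Matrix.adjugate_apply, det_eq_mul_of_perm_preserves _ P, Matrix.adjugate_apply]
  · congr 2
    · ext i j
      by_cases hi : i = ⟨y, hyP⟩
      · subst hi
        simp [subm, Pi.single_apply, Subtype.ext_iff]
      · have hi' : (i : V) ≠ y := fun h => hi (Subtype.ext h)
        simp [subm, Matrix.updateRow_ne hi, Matrix.updateRow_ne hi']
    · ext i j
      have hi' : (i : V) ≠ y := fun h => Finset.mem_compl.1 i.2 (h ▸ hyP)
      simp [subm, Matrix.updateRow_ne hi']
  · intro σ hσ i hi
    have hx : σ x = y := by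
      have h := hσ (σ.symm y)
      rw [Equiv.apply_symm_apply, Matrix.updateRow_self, Pi.single_apply] at h
      have h' : σ.symm y = x := by
        by_contra hne
        simp [hne] at h
      rw [← h', Equiv.apply_symm_apply]
    rw [hP] at hi ⊢
    refine perm_mem_support_of_unique_path huniq σ hx (fun j hj hne => ?_) hi
    have hy : σ j ≠ y := fun h => hj (σ.injective (h.trans hx.symm))
    have h := hσ j
    rw [Matrix.updateRow_ne hy] at h
    exact hK _ _ hne h

/-- The determinant is monotone on adding a positive semidefinite matrix to a positive
definite one. -/
theorem det_le_det_add_posSemidef {n : Type*} [Fintype n] [DecidableEq n]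
    {M N : Matrix n n ℝ} (hM : M.PosDef) (hN : N.PosSemidef) : M.det ≤ (M + N).det := by
  have one_le : ∀ {A : Matrix n n ℝ}, A.PosSemidef → 1 ≤ (1 + A).det := by
    intro A hA
    have h := congrArg (Polynomial.eval (-1)) hA.isHermitian.charpoly_eq
    rw [Matrix.eval_charpoly, Polynomial.eval_prod] at h
    have h1 : Matrix.scalar n (-1 : ℝ) - A = -(1 + A) := by
      rw [map_neg, map_one]; abel
    have h2 : ∏ i, Polynomial.eval (-1)
        (Polynomial.X - Polynomial.C (RCLike.ofReal (hA.isHermitian.eigenvalues i) : ℝ)) =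
        (-1) ^ Fintype.card n * ∏ i, (1 + hA.isHermitian.eigenvalues i) := by
      rw [← Finset.card_univ, ← Finset.prod_const, ← Finset.prod_mul_distrib]
      refine Finset.prod_congr rfl fun i _ => ?_
      simp
      ring
    rw [h1, Matrix.det_neg, h2] at h
    rw [mul_left_cancel₀ (pow_ne_zero _ (by norm_num)) h]
    refine Finset.prod_induction _ (1 ≤ ·) (fun _ _ => one_le_mul_of_one_le_of_one_le) le_rfl
      fun i _ => ?_
    linarith [hA.eigenvalues_nonneg i]
  obtain ⟨C, hC, rfl⟩ : ∃ C : Matrix n n ℝ, IsUnit C.det ∧ M = Cᴴ * C := by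
    open scoped MatrixOrder in
    obtain ⟨C, hC⟩ := CStarAlgebra.nonneg_iff_eq_star_mul_self.mp hM.posSemidef.nonneg
    refine ⟨C, ?_, hC⟩
    have := hM.det_pos
    rw [hC, Matrix.det_mul] at this
    exact (right_ne_zero_of_mul this.ne').isUnit
  have hfac : Cᴴ * C + N = Cᴴ * (1 + (C⁻¹)ᴴ * N * C⁻¹) * C := by
    have h1 : Cᴴ * (C⁻¹)ᴴ = 1 := by
      rw [← Matrix.conjTranspose_mul, Matrix.nonsing_inv_mul _ hC, Matrix.conjTranspose_one]
    rw [Matrix.mul_add, Matrix.add_mul, Matrix.mul_one, Matrix.mul_assoc (C⁻¹)ᴴ,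
      ← Matrix.mul_assoc Cᴴ, h1, Matrix.one_mul, Matrix.mul_assoc, Matrix.nonsing_inv_mul _ hC,
      Matrix.mul_one]
  rw [hfac, Matrix.det_mul, Matrix.det_mul, Matrix.det_mul, mul_right_comm]
  refine le_mul_of_one_le_right ?_ (one_le (hN.conjTranspose_mul_mul_same _))
  rw [← Matrix.det_mul]
  exact hM.det_pos.le

theorem subm_posDef {V : Type*} [Fintype V] [DecidableEq V] {S : Matrix V V ℝ}
    (hS : S.PosDef) (P : Finset V) : (subm S P P).PosDef :=
  hS.submatrix Subtype.val_injective

theorem det_eq_det_mul_det_pcov {V : Type*} [Fintype V] [DecidableEq V] {S : Matrix V V ℝ}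
    (hS : S.PosDef) (P : Finset V) :
    S.det = (subm S Pᶜ Pᶜ).det * (pcov S P).det := by
  let := (subm_posDef hS Pᶜ).isUnit.invertible
  rw [← Matrix.det_submatrix_equiv_self (sumComplEquiv P), submatrix_sumComplEquiv,
    Matrix.det_fromBlocks₂₂, Matrix.invOf_eq_nonsing_inv]
  rfl

theorem det_pcov_pos {V : Type*} [Fintype V] [DecidableEq V] {S : Matrix V V ℝ}
    (hS : S.PosDef) (P : Finset V) : 0 < (pcov S P).det := by
  have h := hS.det_pos
  rw [det_eq_det_mul_det_pcov hS P] at h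
  exact pos_of_mul_pos_right h (subm_posDef hS Pᶜ).det_pos.le

/-- The block of the concentration matrix on `P` is the inverse partial covariance. -/
theorem subm_inv_eq {V : Type*} [Fintype V] [DecidableEq V] {S : Matrix V V ℝ}
    (hS : S.PosDef) (P : Finset V) : subm S⁻¹ P P = (pcov S P)⁻¹ := by
  let := (subm_posDef hS Pᶜ).isUnit.invertible
  have hu : IsUnit (pcov S P) :=
    (Matrix.isUnit_iff_isUnit_det _).2 (det_pcov_pos hS P).ne'.isUnit
  have hpc : subm S P P - subm S P Pᶜ * ⅟(subm S Pᶜ Pᶜ) * subm S Pᶜ P = pcov S P := by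
    rw [Matrix.invOf_eq_nonsing_inv]
    rfl
  let : Invertible (subm S P P - subm S P Pᶜ * ⅟(subm S Pᶜ Pᶜ) * subm S Pᶜ P) :=
    (hpc ▸ hu).invertible
  let := Matrix.fromBlocks₂₂Invertible (subm S P P) (subm S P Pᶜ) (subm S Pᶜ P) (subm S Pᶜ Pᶜ)
  have h := Matrix.invOf_fromBlocks₂₂_eq (subm S P P) (subm S P Pᶜ) (subm S Pᶜ P)
    (subm S Pᶜ Pᶜ)
  rw [Matrix.invOf_eq_nonsing_inv, ← submatrix_sumComplEquiv, Matrix.inv_submatrix_equiv,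
    submatrix_sumComplEquiv] at h
  rw [(Matrix.fromBlocks_inj.1 h).1, Matrix.invOf_eq_nonsing_inv, hpc]

theorem det_subm_inv_compl {V : Type*} [Fintype V] [DecidableEq V] {S : Matrix V V ℝ}
    (hS : S.PosDef) (P : Finset V) :
    (subm S⁻¹ Pᶜ Pᶜ).det = (subm S P P).det / S.det := by
  have h := det_eq_det_mul_det_pcov hS Pᶜ
  rw [compl_compl] at h
  rw [subm_inv_eq hS, Matrix.det_nonsing_inv, Ring.inverse_eq_inv, h, div_mul_cancel_left₀]
  exact (subm_posDef hS P).det_pos.ne'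

theorem inflF_compl_eq {V : Type*} [Fintype V] [DecidableEq V] (S : Matrix V V ℝ)
    (P : Finset V) :
    inflF S P Pᶜ = (subm S P P).det * (subm S Pᶜ Pᶜ).det / S.det := by
  rw [inflF, Finset.union_compl]
  congr 1
  exact Matrix.det_submatrix_equiv_self (Equiv.subtypeUnivEquiv Finset.mem_univ) S

/-- **Fischer's inequality**: the inflation factor is at least one. -/
theorem one_le_inflF_compl {V : Type*} [Fintype V] [DecidableEq V] {S : Matrix V V ℝ}
    (hS : S.PosDef) (P : Finset V) : 1 ≤ inflF S P Pᶜ := by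
  have hQ := (subm_posDef hS Pᶜ)
  have hherm : subm S Pᶜ P = (subm S P Pᶜ)ᴴ := by
    ext i j
    exact (hS.isHermitian.apply _ _).symm
  have hpsd : (subm S P Pᶜ * (subm S Pᶜ Pᶜ)⁻¹ * subm S Pᶜ P).PosSemidef := by
    rw [hherm]
    exact hQ.inv.posSemidef.mul_mul_conjTranspose_same _
  have hM : (pcov S P).PosDef := by
    have h := subm_posDef hS.inv P
    rw [subm_inv_eq hS] at h
    exact Matrix.posDef_inv_iff.1 h
  have hle := det_le_det_add_posSemidef hM hpsd
  rw [pcov, pcovOn, sub_add_cancel] at hle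
  rw [inflF_compl_eq, one_le_div hS.det_pos, det_eq_det_mul_det_pcov hS P, mul_comm]
  exact mul_le_mul_of_nonneg_right hle hQ.det_pos.le

theorem adjugate_inv_apply {n : Type*} [Fintype n] [DecidableEq n] {A : Matrix n n ℝ}
    (hA : A.det ≠ 0) (i j : n) : A⁻¹.adjugate i j = A i j / A.det := by
  have h := Matrix.inv_def A⁻¹
  rw [Matrix.nonsing_inv_nonsing_inv _ hA.isUnit, Matrix.det_nonsing_inv, Ring.inverse_eq_inv,
    Ring.inverse_eq_inv, inv_inv] at h
  have h' := congrFun (congrFun h i) j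
  rw [Matrix.smul_apply, smul_eq_mul] at h'
  rw [h', mul_div_cancel_left₀ _ hA]

theorem real_sign_mul_of_pos_right (a : ℝ) {b : ℝ} (hb : 0 < b) :
    Real.sign (a * b) = Real.sign a := by
  have h : a * b < 0 ↔ a < 0 := by
    rw [← neg_pos, ← neg_mul, mul_pos_iff_of_pos_right hb, neg_pos]
  simp only [Real.sign, mul_pos_iff_of_pos_right hb, h]

/-- covariance factorization along a unique path:
`σ_xy = σ_{xy·P̄} × IF_P`, same sign and `|σ_xy| ≥ |σ_{xy·P̄}|`. -/
theorem unique_path_covariance_factorization {V : Type*} [Fintype V] [DecidableEq V]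
    (S : Matrix V V ℝ) (hS : S.PosDef) (G : SimpleGraph V) [DecidableRel G.Adj]
    (hadapt : Adapted S⁻¹ G) {x y : V} (hxy : x ≠ y) (p : G.Walk x y) (hp : p.IsPath)
    (huniq : ∀ q : G.Walk x y, q.IsPath → q = p) :
    S x y =
      pcov S p.support.toFinset
          ⟨x, List.mem_toFinset.mpr p.start_mem_support⟩
          ⟨y, List.mem_toFinset.mpr p.end_mem_support⟩ *
        inflF S p.support.toFinset p.support.toFinsetᶜ ∧
    Real.sign (S x y) =
      Real.sign (pcov S p.support.toFinset
          ⟨x, List.mem_toFinset.mpr p.start_mem_support⟩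
          ⟨y, List.mem_toFinset.mpr p.end_mem_support⟩) ∧
    |pcov S p.support.toFinset
        ⟨x, List.mem_toFinset.mpr p.start_mem_support⟩
        ⟨y, List.mem_toFinset.mpr p.end_mem_support⟩| ≤ |S x y| := by
  have hxP : x ∈ p.support.toFinset := List.mem_toFinset.mpr p.start_mem_support
  have hyP : y ∈ p.support.toFinset := List.mem_toFinset.mpr p.end_mem_support
  set P := p.support.toFinset with hP
  have hIF := one_le_inflF_compl hS P
  have hmain : S x y = pcov S P ⟨x, hxP⟩ ⟨y, hyP⟩ * inflF S P Pᶜ := by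
    have h := adjugate_eq_of_unique_path S⁻¹ hadapt p huniq P
      (fun v => by rw [hP, List.mem_toFinset]) hxP hyP
    rw [adjugate_inv_apply hS.det_pos.ne', subm_inv_eq hS,
      adjugate_inv_apply (det_pcov_pos hS P).ne', det_subm_inv_compl hS] at h
    have h1 := (det_pcov_pos hS P).ne'
    have h2 := (subm_posDef hS Pᶜ).det_pos.ne'
    rw [inflF_compl_eq]
    rw [det_eq_det_mul_det_pcov hS P] at h ⊢
    field_simp at h ⊢
    exact h
  refine ⟨hmain, ?_, ?_⟩
  · rw [hmain, real_sign_mul_of_pos_right _ (zero_lt_one.trans_le hIF)]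
  · rw [hmain, abs_mul, abs_of_nonneg (zero_le_one.trans hIF)]
    exact le_mul_of_one_le_right (abs_nonneg _) hIF
end

section
/- Correlation factorization along chordless and unique paths. Let K = Σ⁻¹ be adapted to G = (V,E) and let π be a path between x and y in G with P = V(π). If π is chordless, then ω(π, Ω_{[P|P̄]}) = ρ_{xy·P̄}, so that ω(π,Ω) = ρ_{xy·P̄} × IF_P / √(IF_x^{P̄} · IF_y^{P̄}). If moreover π is the unique path between x and y in G, then ω(π,Ω) = ρ_xy, so that ρ_xy = ρ_{xy·P̄} × IF_P / √(IF_x^{P̄} · IF_y^{P̄}). -/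
open Matrix BigOperators Finset

variable {V : Type*} [Fintype V] [DecidableEq V]

/-- The matrix `K` on the block `A × A`, extended by the identity outside of `A`. -/
noncomputable def blockMask (K : Matrix V V ℝ) (A : Finset V) : Matrix V V ℝ :=
  Matrix.of fun i j => if i ∈ A ∧ j ∈ A then K i j else if i = j then 1 else 0

lemma det_blockMask (K : Matrix V V ℝ) (A : Finset V) :
    (blockMask K A).det = (subm K A A).det := by
  rw [Matrix.twoBlockTriangular_det' (blockMask K A) (fun i => i ∈ A)]
  · have h1 : toSquareBlockProp (blockMask K A) (fun i => i ∈ A) = subm K A A := by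
      ext i j
      simp [toSquareBlockProp_def, blockMask, subm]
    have h2 : toSquareBlockProp (blockMask K A) (fun i => ¬ i ∈ A) = 1 := by
      ext i j
      simp [toSquareBlockProp_def, blockMask, i.2, Matrix.one_apply, Subtype.ext_iff]
    rw [h2, det_one, mul_one]
    convert congrArg det h1
  · intro i hi j hj
    have : i ≠ j := fun h => hj (h ▸ hi)
    simp [blockMask, hj, this]

lemma blockMask_univ (K : Matrix V V ℝ) : blockMask K Finset.univ = K := by
  ext i j
  simp [blockMask]

lemma det_subm_univ (K : Matrix V V ℝ) : (subm K Finset.univ Finset.univ).det = K.det := by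
  rw [← det_blockMask, blockMask_univ]

lemma inv_blockMask_apply (K : Matrix V V ℝ) (A : Finset V) (hA : (subm K A A).det ≠ 0)
    (i j : A) : (blockMask K A)⁻¹ i j = (subm K A A)⁻¹ i j := by
  have hu : IsUnit (blockMask K A).det := by
    rw [det_blockMask]
    exact hA.isUnit
  have h : subm (blockMask K A)⁻¹ A A * subm K A A = 1 := by
    ext a b
    have h1 := congrFun (congrFun (Matrix.nonsing_inv_mul _ hu) a) b
    rw [Matrix.mul_apply] at h1
    rw [Matrix.mul_apply]
    have h2 : ∑ u : A, subm (blockMask K A)⁻¹ A A a u * subm K A A u b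
        = ∑ u ∈ A, (blockMask K A)⁻¹ a u * K u b :=
      Finset.sum_coe_sort A (fun u => (blockMask K A)⁻¹ a u * K u b)
    rw [h2]
    have h3 : ∑ u, (blockMask K A)⁻¹ a u * blockMask K A u b
        = ∑ u ∈ A, (blockMask K A)⁻¹ a u * K u b := by
      symm
      rw [← Finset.sum_subset (Finset.subset_univ A)]
      · refine Finset.sum_congr rfl fun u hu => ?_
        simp [blockMask, hu]
      · intro u _ hu
        have : u ≠ b := fun h => hu (h ▸ b.2)
        simp [blockMask, hu, this]
    rw [← h3, h1]
    by_cases hab : a = b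
    · subst hab
      rw [Matrix.one_apply_eq, Matrix.one_apply_eq]
    · rw [Matrix.one_apply_ne hab, Matrix.one_apply_ne fun e => hab (Subtype.ext e)]
  rw [Matrix.inv_eq_left_inv h]
  rfl

/-- First step expansion of an inverse, where `D` is obtained from `M` by replacing row and
column `x` by the corresponding unit vectors. -/
lemma inv_apply_eq_neg_mul_sum (M D : Matrix V V ℝ) {x y : V} (hxy : x ≠ y)
    (hM : M.det ≠ 0) (hD : D.det ≠ 0) (hrow : ∀ j, D x j = if x = j then 1 else 0)
    (hcol : ∀ i, i ≠ x → D i x = 0) (hDM : ∀ i j, i ≠ x → j ≠ x → D i j = M i j) :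
    M⁻¹ x y = -M⁻¹ x x * ∑ u ∈ Finset.univ.erase x, M x u * D⁻¹ u y := by
  set r : V → ℝ := M⁻¹ x with hr
  set k : V → ℝ := fun u => if u = x then 0 else M x u with hk
  have hrM : ∀ j, ∑ u, r u * M u j = if x = j then 1 else 0 := by
    intro j
    have := congrFun (congrFun (Matrix.nonsing_inv_mul M hM.isUnit) x) j
    rwa [Matrix.mul_apply, Matrix.one_apply] at this
  have hrD : r ᵥ* D = r x • Pi.single x 1 - r x • k := by
    funext j
    simp only [Matrix.vecMul, dotProduct, Pi.sub_apply, Pi.smul_apply, smul_eq_mul]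
    rw [← Finset.add_sum_erase _ _ (Finset.mem_univ x), hrow]
    by_cases hj : j = x
    · subst hj
      rw [Finset.sum_eq_zero]
      · simp [hk]
      · intro u hu
        rw [hcol u (Finset.ne_of_mem_erase hu), mul_zero]
    · have h1 := hrM j
      rw [← Finset.add_sum_erase _ _ (Finset.mem_univ x), if_neg (Ne.symm hj)] at h1
      have h2 : ∑ u ∈ Finset.univ.erase x, r u * D u j
          = ∑ u ∈ Finset.univ.erase x, r u * M u j :=
        Finset.sum_congr rfl fun u hu => by rw [hDM u j (Finset.ne_of_mem_erase hu) hj]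
      rw [h2, Pi.single_eq_of_ne hj]
      simp only [hk, if_neg hj, if_neg (Ne.symm hj)]
      linear_combination h1
  have hsD : (Pi.single x 1 : V → ℝ) ᵥ* D = Pi.single x 1 := by
    funext j
    simp [hrow, Pi.single_apply, eq_comm]
  have hsD' : (Pi.single x 1 : V → ℝ) ᵥ* D⁻¹ = Pi.single x 1 := by
    conv_lhs => rw [← hsD]
    rw [Matrix.vecMul_vecMul, Matrix.mul_nonsing_inv D hD.isUnit, Matrix.vecMul_one]
  have hfin : r = r x • Pi.single x 1 - r x • (k ᵥ* D⁻¹) := by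
    have := congrArg (fun v => v ᵥ* D⁻¹) hrD
    simp only [Matrix.vecMul_vecMul, Matrix.mul_nonsing_inv D hD.isUnit, Matrix.vecMul_one,
      Matrix.sub_vecMul, Matrix.smul_vecMul, hsD'] at this
    exact this
  have hy := congrFun hfin y
  rw [hy]
  have hkD : (k ᵥ* D⁻¹) y = ∑ u ∈ Finset.univ.erase x, M x u * D⁻¹ u y := by
    simp only [Matrix.vecMul, dotProduct]
    rw [← Finset.add_sum_erase _ _ (Finset.mem_univ x)]
    simp only [hk, if_true, zero_mul, zero_add]
    exact Finset.sum_congr rfl fun u hu => by rw [if_neg (Finset.ne_of_mem_erase hu)]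
  simp [hkD, Ne.symm hxy]

lemma inv_apply_self_mul_det (M D : Matrix V V ℝ) (x : V)
    (hM : M.det ≠ 0) (hrow : ∀ j, D x j = if x = j then 1 else 0)
    (hDM : ∀ i j, i ≠ x → j ≠ x → D i j = M i j) :
    M⁻¹ x x * M.det = D.det := by
  have h1 : M⁻¹ x x * M.det = M.adjugate x x := by
    rw [Matrix.inv_def, Matrix.smul_apply, smul_eq_mul, Ring.inverse_eq_inv']
    field_simp
  rw [h1, Matrix.adjugate_apply, Matrix.twoBlockTriangular_det' _ (fun i => i = x),
    Matrix.twoBlockTriangular_det' D (fun i => i = x)]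
  · congr 1
    · congr 1
      ext ⟨i, hi⟩ ⟨j, hj⟩
      subst hi
      subst hj
      simp [toSquareBlockProp_def, hrow]
    · congr 1
      ext ⟨i, hi⟩ ⟨j, hj⟩
      simp [toSquareBlockProp_def, hDM i j hi hj, hi]
  · rintro i rfl j hj
    simp [hrow, Ne.symm hj]
  · rintro i rfl j hj
    simp [hj]

/-- The inverse of a matrix which is block diagonal with respect to `C` and its complement is
block diagonal. -/
lemma inv_apply_eq_zero_of_block (M : Matrix V V ℝ) (hM : M.det ≠ 0) (C : V → Prop)
    (h1 : ∀ a b, C a → ¬ C b → M a b = 0) (h2 : ∀ a b, ¬ C a → C b → M a b = 0)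
    {u y : V} (hu : C u) (hy : ¬ C y) : M⁻¹ u y = 0 := by
  classical
  set E : Matrix V V ℝ := Matrix.diagonal fun a => if C a then 1 else 0 with hE
  have hcomm : E * M = M * E := by
    ext a b
    rw [hE, Matrix.diagonal_mul, Matrix.mul_diagonal]
    by_cases ha : C a <;> by_cases hb : C b <;> simp [ha, hb, h1, h2]
  have hcomm' : M⁻¹ * E = E * M⁻¹ := by
    calc M⁻¹ * E = M⁻¹ * E * (M * M⁻¹) := by
          rw [Matrix.mul_nonsing_inv M hM.isUnit, Matrix.mul_one]
      _ = M⁻¹ * (E * M) * M⁻¹ := by simp only [Matrix.mul_assoc]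
      _ = M⁻¹ * M * (E * M⁻¹) := by rw [hcomm]; simp only [Matrix.mul_assoc]
      _ = E * M⁻¹ := by rw [Matrix.nonsing_inv_mul M hM.isUnit, Matrix.one_mul]
  have := congrFun (congrFun hcomm' u) y
  rw [hE, Matrix.diagonal_mul, Matrix.mul_diagonal] at this
  simpa [hu, hy] using this.symm

/-- If the entry `(u, y)` of the inverse of the block `A` of an adapted symmetric matrix does not
vanish, some path inside `A` joins `u` and `y`. -/
lemma exists_isPath_of_inv_blockMask_ne_zero {K : Matrix V V ℝ} {G : SimpleGraph V}
    (hK : Adapted K G) (hsymm : ∀ i j, K i j = K j i) (A : Finset V)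
    (hA : (subm K A A).det ≠ 0) {u y : V} (hu : u ∈ A) (h : (blockMask K A)⁻¹ u y ≠ 0) :
    ∃ q : G.Walk u y, q.IsPath ∧ ∀ w ∈ q.support, w ∈ A := by
  classical
  by_contra hno
  set C : V → Prop := fun v => ∃ q : G.Walk u v, ∀ w ∈ q.support, w ∈ A with hC
  have key : ∀ a b, C a → ¬ C b → blockMask K A a b = 0 := by
    rintro a b ⟨q, hq⟩ hb
    by_contra hne
    have hab : a ≠ b := by
      rintro rfl
      exact hb ⟨q, hq⟩
    simp only [blockMask, Matrix.of_apply, if_neg hab] at hne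
    by_cases hc : a ∈ A ∧ b ∈ A
    · rw [if_pos hc] at hne
      refine hb ⟨q.concat (hK a b hab hne), fun w hw => ?_⟩
      rw [SimpleGraph.Walk.support_concat, List.mem_append] at hw
      rcases hw with hw | hw
      · exact hq w hw
      · simp at hw
        exact hw ▸ hc.2
    · rw [if_neg hc] at hne
      exact hne rfl
  refine h (inv_apply_eq_zero_of_block _ (by rwa [det_blockMask]) C key ?_
    ⟨SimpleGraph.Walk.nil, by simpa using hu⟩ ?_)
  · intro a b ha hb
    rw [← key b a hb ha]
    simp only [blockMask, Matrix.of_apply, hsymm a b, and_comm, eq_comm]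
  · rintro ⟨q, hq⟩
    exact hno ⟨q.bypass, q.bypass_isPath, fun w hw => hq w (q.support_bypass_subset_support hw)⟩

lemma inv_blockMask_mul_det_of_unique_path {K : Matrix V V ℝ} {G : SimpleGraph V}
    (hK : Adapted K G) (hsymm : ∀ i j, K i j = K j i)
    (hdet : ∀ A : Finset V, (subm K A A).det ≠ 0) {x y : V} (p : G.Walk x y) (hp : p.IsPath)
    (A : Finset V) (hpA : ∀ w ∈ p.support, w ∈ A)
    (huniq : ∀ q : G.Walk x y, q.IsPath → (∀ w ∈ q.support, w ∈ A) → q = p) :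
    (blockMask K A)⁻¹ x y * (subm K A A).det = (-1) ^ p.length *
      (subm K (A \ p.support.toFinset) (A \ p.support.toFinset)).det *
      (p.darts.map fun d => K d.toProd.1 d.toProd.2).prod := by
  have hM : ∀ A, (blockMask K A).det ≠ 0 := fun A => by rw [det_blockMask]; exact hdet A
  have hrow : ∀ (A : Finset V) (x j : V),
      blockMask K (A.erase x) x j = if x = j then 1 else 0 := by
    intro A x j
    simp [blockMask]
  have hcol : ∀ (A : Finset V) (x i : V), i ≠ x → blockMask K (A.erase x) i x = 0 := by
    intro A x i hi
    simp [blockMask, hi]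
  have hDM : ∀ (A : Finset V) (x i j : V), i ≠ x → j ≠ x →
      blockMask K (A.erase x) i j = blockMask K A i j := by
    intro A x i j hi hj
    simp [blockMask, hi, hj]
  induction p generalizing A with
  | @nil x =>
    have := inv_apply_self_mul_det _ _ x (hM A) (hrow A x) (hDM A x)
    rw [det_blockMask, det_blockMask] at this
    rw [this]
    have hset : A \ (SimpleGraph.Walk.nil : G.Walk x x).support.toFinset = A.erase x := by
      ext w
      simp [and_comm]
    rw [hset]
    simp
  | @cons x z y h p' ih =>
    rw [SimpleGraph.Walk.cons_isPath_iff] at hp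
    have hxA : x ∈ A := hpA x (by simp)
    have hzA : z ∈ A := hpA z (by simp)
    have hxy : x ≠ y := fun e => hp.2 (e ▸ p'.end_mem_support)
    have hzx : z ≠ x := h.ne'
    have hlift : ∀ {u : V} (hu : G.Adj x u) (q : G.Walk u y), q.IsPath →
        (∀ w ∈ q.support, w ∈ A.erase x) →
        SimpleGraph.Walk.cons hu q = SimpleGraph.Walk.cons h p' := by
      intro u hu q hq hqA
      refine huniq _ ?_ ?_
      · rw [SimpleGraph.Walk.cons_isPath_iff]
        exact ⟨hq, fun hx => by simpa using hqA x hx⟩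
      · intro w hw
        rw [SimpleGraph.Walk.support_cons, List.mem_cons] at hw
        rcases hw with rfl | hw
        · exact hxA
        · exact Finset.mem_of_mem_erase (hqA w hw)
    have ih' := ih hp.1 (A.erase x)
      (fun w hw => Finset.mem_erase.mpr
        ⟨fun e => hp.2 (e ▸ hw), hpA w (by simp [hw])⟩)
      (fun q hq hqA => by
        have := hlift h q hq hqA
        simpa using this)
    have hstep := inv_apply_eq_neg_mul_sum _ _ hxy (hM A) (hM (A.erase x)) (hrow A x)
      (hcol A x) (hDM A x)
    have hself := inv_apply_self_mul_det _ _ x (hM A) (hrow A x) (hDM A x)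
    rw [det_blockMask, det_blockMask] at hself
    rw [Finset.sum_eq_single z] at hstep
    · have hxz : blockMask K A x z = K x z := by simp [blockMask, hxA, hzA]
      have hset : A \ (SimpleGraph.Walk.cons h p').support.toFinset
          = (A.erase x) \ p'.support.toFinset := by
        ext w
        simp
        tauto
      rw [hstep, hset, hxz]
      simp only [SimpleGraph.Walk.length_cons, SimpleGraph.Walk.darts_cons, List.map_cons,
        List.prod_cons, pow_succ]
      linear_combination (-(K x z) * (blockMask K (A.erase x))⁻¹ z y) * hself - (K x z) * ih'
    · intro u hu huz
      by_contra hne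
      have hux : u ≠ x := Finset.ne_of_mem_erase hu
      have hne1 := left_ne_zero_of_mul hne
      have hne2 := right_ne_zero_of_mul hne
      simp only [blockMask, Matrix.of_apply, if_neg hux.symm] at hne1
      by_cases huA : x ∈ A ∧ u ∈ A
      · rw [if_pos huA] at hne1
        have hadj := hK x u hux.symm hne1
        obtain ⟨q, hq, hqA⟩ := exists_isPath_of_inv_blockMask_ne_zero hK hsymm (A.erase x)
          (hdet _) (Finset.mem_erase.mpr ⟨hux, huA.2⟩) hne2
        have := hlift hadj q hq hqA
        rw [SimpleGraph.Walk.cons.injEq] at this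
        exact huz this.1
      · rw [if_neg huA] at hne1
        exact hne1 rfl
    · intro hz
      exact absurd (Finset.mem_erase.mpr ⟨hzx, Finset.mem_univ z⟩) hz

lemma Chordless.of_cons {W : Type*} {G : SimpleGraph W} {x z y : W} {h : G.Adj x z} {p : G.Walk z y}
    (hc : Chordless (SimpleGraph.Walk.cons h p)) (hx : x ∉ p.support) : Chordless p := by
  intro u v hu hv huv
  have := hc u v (by simp [hu]) (by simp [hv]) huv
  rw [SimpleGraph.Walk.edges_cons, List.mem_cons] at this
  rcases this with h' | h'
  · rw [Sym2.eq_iff] at h'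
    rcases h' with ⟨rfl, rfl⟩ | ⟨rfl, rfl⟩
    · exact absurd hu hx
    · exact absurd hv hx
  · exact h'

lemma Chordless.eq_of_support_subset {W : Type*} {G : SimpleGraph W} {x y : W} {p : G.Walk x y}
    (hc : Chordless p) (hp : p.IsPath) (q : G.Walk x y) (hq : q.IsPath)
    (hqp : ∀ w ∈ q.support, w ∈ p.support) : q = p := by
  induction p with
  | nil => simpa using hq
  | @cons x z y h p' ih =>
    rw [SimpleGraph.Walk.cons_isPath_iff] at hp
    cases q with
    | nil => exact absurd p'.end_mem_support hp.2
    | @cons _ u _ h' q' =>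
      rw [SimpleGraph.Walk.cons_isPath_iff] at hq
      have hu := hc x u (by simp) (hqp u (by simp)) h'
      rw [SimpleGraph.Walk.edges_cons, List.mem_cons] at hu
      have huz : u = z := by
        rcases hu with hu | hu
        · rw [Sym2.eq_iff] at hu
          rcases hu with hu | hu
          · exact hu.2
          · exact hu.2.trans hu.1
        · exact absurd (p'.fst_mem_support_of_mem_edges hu) hp.2
      subst huz
      rw [ih (hc.of_cons hp.2) hp.1 q' hq.1]
      intro w hw
      have := hqp w (by simp [hw])
      rw [SimpleGraph.Walk.support_cons, List.mem_cons] at this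
      rcases this with rfl | this
      · exact absurd hw hq.2
      · exact this

/-- The weight of a walk inside the block `A` of the matrix `K`. -/
noncomputable def blockWeight (K : Matrix V V ℝ) (A : Finset V) {G : SimpleGraph V}
    {x y : V} (p : G.Walk x y) : ℝ :=
  (-1 : ℝ) ^ (p.support.toFinset.card + 1) *
    ((subm K (A \ p.support.toFinset) (A \ p.support.toFinset)).det / (subm K A A).det) *
    (p.darts.map fun d => K d.toProd.1 d.toProd.2).prod

lemma blockWeight_eq_inv_apply {K : Matrix V V ℝ} {G : SimpleGraph V}
    (hK : Adapted K G) (hsymm : ∀ i j, K i j = K j i)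
    (hdet : ∀ A : Finset V, (subm K A A).det ≠ 0) {x y : V} (p : G.Walk x y) (hp : p.IsPath)
    (A : Finset V) (hpA : ∀ w ∈ p.support, w ∈ A)
    (huniq : ∀ q : G.Walk x y, q.IsPath → (∀ w ∈ q.support, w ∈ A) → q = p) :
    blockWeight K A p = (blockMask K A)⁻¹ x y := by
  have h := inv_blockMask_mul_det_of_unique_path hK hsymm hdet p hp A hpA huniq
  have hcard : p.support.toFinset.card = p.length + 1 := by
    rw [List.toFinset_card_of_nodup hp.support_nodup, SimpleGraph.Walk.length_support]
  have hA := hdet A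
  rw [blockWeight, hcard, pow_succ, pow_succ]
  field_simp
  linear_combination -h

omit [Fintype V] in
lemma det_subm_scale (K : Matrix V V ℝ) (s : V → ℝ) (A : Finset V) :
    (subm (Matrix.of fun u v => s u * K u v * s v) A A).det
      = (∏ u ∈ A, s u) ^ 2 * (subm K A A).det := by
  have h : subm (Matrix.of fun u v => s u * K u v * s v) A A
      = Matrix.diagonal (fun u : A => s u) * subm K A A * Matrix.diagonal (fun u : A => s u) := by
    ext i j
    rw [Matrix.mul_diagonal, Matrix.diagonal_mul]
    rfl
  rw [h, Matrix.det_mul, Matrix.det_mul, Matrix.det_diagonal, Finset.prod_coe_sort A s]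
  ring

omit [Fintype V] in
lemma prod_darts_scale (K : Matrix V V ℝ) (s : V → ℝ) {G : SimpleGraph V} {x y : V}
    (p : G.Walk x y) (hp : p.IsPath) :
    (p.darts.map fun d => s d.toProd.1 * K d.toProd.1 d.toProd.2 * s d.toProd.2).prod
        * (s x * s y)
      = (∏ u ∈ p.support.toFinset, s u) ^ 2
        * (p.darts.map fun d => K d.toProd.1 d.toProd.2).prod := by
  induction p with
  | nil => simp [sq]
  | @cons x z y h p' ih =>
    rw [SimpleGraph.Walk.cons_isPath_iff] at hp
    have ih' := ih hp.1
    rw [SimpleGraph.Walk.support_cons, List.toFinset_cons,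
      Finset.prod_insert (by simpa using hp.2)]
    simp only [SimpleGraph.Walk.darts_cons, List.map_cons, List.prod_cons]
    linear_combination (s x ^ 2 * K x z) * ih'

omit [Fintype V] in
lemma blockWeight_scale (K : Matrix V V ℝ) (s : V → ℝ) (hs : ∀ v, s v ≠ 0)
    {G : SimpleGraph V} {x y : V} (p : G.Walk x y) (hp : p.IsPath)
    (A : Finset V) (hpA : ∀ w ∈ p.support, w ∈ A) (hA : (subm K A A).det ≠ 0) :
    blockWeight (Matrix.of fun u v => s u * K u v * s v) A p = blockWeight K A p / (s x * s y) := by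
  have hd := prod_darts_scale K s p hp
  have hprod : (∏ u ∈ A \ p.support.toFinset, s u) * ∏ u ∈ p.support.toFinset, s u
      = ∏ u ∈ A, s u :=
    Finset.prod_sdiff fun w hw => hpA w (List.mem_toFinset.mp hw)
  have h1 : ∏ u ∈ A \ p.support.toFinset, s u ≠ 0 := Finset.prod_ne_zero_iff.mpr fun v _ => hs v
  have h2 : ∏ u ∈ p.support.toFinset, s u ≠ 0 := Finset.prod_ne_zero_iff.mpr fun v _ => hs v
  have hx := hs x
  have hy := hs y
  rw [blockWeight, blockWeight, det_subm_scale, det_subm_scale, ← hprod,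
    eq_div_iff (mul_ne_zero hx hy)]
  simp only [Matrix.of_apply]
  rw [mul_assoc, hd]
  field_simp

lemma corrScale_inv {ι : Type*} [Fintype ι] [DecidableEq ι] (M : Matrix ι ι ℝ)
    (hdiag : ∀ i, 0 < M i i) (hM : M.det ≠ 0) :
    (corrScale M)⁻¹ = Matrix.of fun i j => √(M i i) * M⁻¹ i j * √(M j j) := by
  refine Matrix.inv_eq_left_inv ?_
  ext i j
  have h := congrFun (congrFun (Matrix.nonsing_inv_mul M hM.isUnit) i) j
  rw [Matrix.mul_apply] at h ⊢
  have hne : ∀ i, √(M i i) ≠ 0 := fun i => (Real.sqrt_pos.mpr (hdiag i)).ne'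
  have hsum : ∑ u, (Matrix.of fun i j => √(M i i) * M⁻¹ i j * √(M j j)) i u * corrScale M u j
      = √(M i i) / √(M j j) * ∑ u, M⁻¹ i u * M u j := by
    rw [Finset.mul_sum]
    refine Finset.sum_congr rfl fun u _ => ?_
    have := hne u
    have := hne j
    simp only [corrScale, Matrix.of_apply]
    field_simp
  rw [hsum, h]
  by_cases hij : i = j
  · subst hij
    simp [hne i]
  · simp [hij]

omit [Fintype V] [DecidableEq V] in
lemma Matrix.PosDef.subm {M : Matrix V V ℝ} (hM : M.PosDef) (A : Finset V) :
    (subm M A A).PosDef :=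
  hM.submatrix (e := fun i : A => (i : V)) Subtype.val_injective

lemma subm_mul_subm_add (M N : Matrix V V ℝ) (A B C : Finset V) :
    subm M A C * subm N C B + subm M A Cᶜ * subm N Cᶜ B = subm (M * N) A B := by
  ext i j
  simp only [Matrix.add_apply, Matrix.mul_apply, subm, Matrix.of_apply]
  rw [Finset.sum_coe_sort C (fun u => M i u * N u j),
    Finset.sum_coe_sort Cᶜ (fun u => M i u * N u j), Finset.sum_add_sum_compl]

lemma pcov_eq_inv {S : Matrix V V ℝ} (hS : S.PosDef) (A : Finset V) :
    pcov S A = (subm S⁻¹ A A)⁻¹ := by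
  symm
  refine Matrix.inv_eq_right_inv ?_
  have hB : IsUnit (subm S Aᶜ Aᶜ).det := (hS.subm Aᶜ).det_pos.ne'.isUnit
  have hone : S⁻¹ * S = 1 := Matrix.nonsing_inv_mul S hS.det_pos.ne'.isUnit
  have h1 := subm_mul_subm_add S⁻¹ S A A A
  have h2 := subm_mul_subm_add S⁻¹ S A Aᶜ A
  rw [hone] at h1 h2
  have h3 : subm (1 : Matrix V V ℝ) A A = 1 := by
    ext i j
    by_cases h : i = j
    · subst h
      simp [subm]
    · rw [Matrix.one_apply_ne h, subm, Matrix.of_apply,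
        Matrix.one_apply_ne fun e => h (Subtype.ext e)]
  have h4 : subm (1 : Matrix V V ℝ) A Aᶜ = 0 := by
    ext i j
    have : (i : V) ≠ j := fun e => (Finset.mem_compl.mp j.2) (e ▸ i.2)
    simp [subm, this]
  rw [h3] at h1
  rw [h4] at h2
  have h5 : subm S⁻¹ A A * subm S A Aᶜ = -(subm S⁻¹ A Aᶜ * subm S Aᶜ Aᶜ) :=
    eq_neg_of_add_eq_zero_left h2
  calc subm S⁻¹ A A * pcov S A
      = subm S⁻¹ A A * subm S A A
          - subm S⁻¹ A A * subm S A Aᶜ * (subm S Aᶜ Aᶜ)⁻¹ * subm S Aᶜ A := by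
        rw [pcov, pcovOn, Matrix.mul_sub]
        simp only [Matrix.mul_assoc]
    _ = subm S⁻¹ A A * subm S A A
          + subm S⁻¹ A Aᶜ * (subm S Aᶜ Aᶜ * (subm S Aᶜ Aᶜ)⁻¹) * subm S Aᶜ A := by
        rw [h5]
        simp only [Matrix.neg_mul, Matrix.mul_assoc, sub_neg_eq_add]
    _ = 1 := by
        rw [Matrix.mul_nonsing_inv _ hB, Matrix.mul_one, h1]

omit [Fintype V] in
lemma det_subm_union {S : Matrix V V ℝ} {A B : Finset V} (hAB : Disjoint A B)
    (hB : (subm S B B).det ≠ 0) :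
    (subm S (A ∪ B) (A ∪ B)).det = (subm S B B).det * (pcovOn S A B).det := by
  let _ : Invertible (subm S B B) := Matrix.invertibleOfIsUnitDet _ hB.isUnit
  have h : (subm S (A ∪ B) (A ∪ B)).submatrix (Equiv.Finset.union A B hAB)
      (Equiv.Finset.union A B hAB)
      = Matrix.fromBlocks (subm S A A) (subm S A B) (subm S B A) (subm S B B) := by
    ext (i | i) (j | j) <;> simp [subm]
  rw [← Matrix.det_submatrix_equiv_self (Equiv.Finset.union A B hAB), h,
    Matrix.det_fromBlocks₂₂, Matrix.invOf_eq_nonsing_inv]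
  rfl

omit [Fintype V] in
lemma inflF_eq_div {S : Matrix V V ℝ} (hS : S.PosDef) {A B : Finset V} (hAB : Disjoint A B) :
    inflF S A B = (subm S A A).det / (pcovOn S A B).det := by
  have hB := (hS.subm B).det_pos.ne'
  rw [inflF, det_subm_union hAB hB]
  by_cases h : (pcovOn S A B).det = 0
  · simp [h]
  · field_simp

lemma det_subm_eq {S : Matrix V V ℝ} (hS : S.PosDef) (A : Finset V) :
    (subm S A A).det = (subm S⁻¹ Aᶜ Aᶜ).det / S⁻¹.det := by
  have h := det_subm_union (S := S) (disjoint_compl_left (a := A)) (hS.subm A).det_pos.ne'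
  have h2 : pcovOn S Aᶜ A = (subm S⁻¹ Aᶜ Aᶜ)⁻¹ := by
    have := pcov_eq_inv hS Aᶜ
    rwa [pcov, compl_compl] at this
  have hu : Aᶜ ∪ A = Finset.univ := by
    rw [Finset.union_comm, Finset.union_compl]
  rw [hu, det_subm_univ, h2] at h
  have hK := (hS.inv.subm Aᶜ).det_pos.ne'
  rw [Matrix.det_nonsing_inv, Ring.inverse_eq_inv'] at h ⊢
  rw [h]
  field_simp

lemma inflF_compl {S : Matrix V V ℝ} (hS : S.PosDef) (A : Finset V) :
    inflF S A Aᶜ = (subm S⁻¹ Aᶜ Aᶜ).det / S⁻¹.det * (subm S⁻¹ A A).det := by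
  rw [inflF_eq_div hS disjoint_compl_right, ← pcov, pcov_eq_inv hS, det_subm_eq hS A,
    Matrix.det_nonsing_inv (subm S⁻¹ A A), Ring.inverse_eq_inv', div_inv_eq_mul]

lemma inflF_singleton_compl {S : Matrix V V ℝ} (hS : S.PosDef) {A : Finset V} (x : A) :
    inflF S {x.1} Aᶜ = S x x / pcov S A x x := by
  rw [inflF_eq_div hS (by simp)]
  rw [Matrix.det_unique, Matrix.det_unique]
  rfl

lemma pathWeight_corrScale {S : Matrix V V ℝ} (hS : S.PosDef) {G : SimpleGraph V} {x y : V}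
    (p : G.Walk x y) (hp : p.IsPath) :
    pathWeight (corrScale S) p = blockWeight S⁻¹ Finset.univ p / (√(S x x) * √(S y y)) := by
  have hdiag : ∀ i, 0 < S i i := fun i => hS.diag_pos
  have h : pathWeight (corrScale S) p = blockWeight (corrScale S)⁻¹ Finset.univ p := by
    rw [pathWeight, blockWeight, det_subm_univ, Finset.compl_eq_univ_sdiff]
  rw [h, corrScale_inv S hdiag hS.det_pos.ne']
  exact blockWeight_scale S⁻¹ (fun v => √(S v v)) (fun v => (Real.sqrt_pos.mpr (hdiag v)).ne')
    p hp Finset.univ (fun w _ => Finset.mem_univ w) (hS.inv.subm _).det_pos.ne'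

lemma subPathWeight_corrScale_pcov {S : Matrix V V ℝ} (hS : S.PosDef) {G : SimpleGraph V}
    {x y : V} (p : G.Walk x y) (hp : p.IsPath) {P : Finset V} (hP : ∀ v, v ∈ p.support ↔ v ∈ P) :
    subPathWeight (corrScale (pcov S P)) p (fun v hv => (hP v).mp hv)
      = blockWeight S⁻¹ P p /
        (√(pcov S P ⟨x, (hP x).mp p.start_mem_support⟩ ⟨x, (hP x).mp p.start_mem_support⟩) *
          √(pcov S P ⟨y, (hP y).mp p.end_mem_support⟩ ⟨y, (hP y).mp p.end_mem_support⟩)) := by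
  have hPD : (pcov S P).PosDef := by
    rw [pcov_eq_inv hS]
    exact (hS.inv.subm P).inv
  have hdiag : ∀ i, 0 < pcov S P i i := fun i => hPD.diag_pos
  set s : V → ℝ := fun v => if h : v ∈ P then √(pcov S P ⟨v, h⟩ ⟨v, h⟩) else 1 with hs
  have hsP : ∀ v : P, s v = √(pcov S P v v) := fun v => by simp [hs]
  have hs0 : ∀ v, s v ≠ 0 := by
    intro v
    by_cases h : v ∈ P
    · rw [hsP ⟨v, h⟩]
      exact (Real.sqrt_pos.mpr (hdiag _)).ne'
    · simp [hs, h]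
  have hinv : (corrScale (pcov S P))⁻¹
      = subm (Matrix.of fun u v => s u * S⁻¹ u v * s v) P P := by
    rw [corrScale_inv _ hdiag hPD.det_pos.ne']
    have h : (pcov S P)⁻¹ = subm S⁻¹ P P := by
      rw [pcov_eq_inv hS, Matrix.nonsing_inv_nonsing_inv _ (hS.inv.subm P).det_pos.ne'.isUnit]
    ext i j
    simp only [h, subm, Matrix.of_apply, hsP]
  have hempty : P \ p.support.toFinset = ∅ := by
    ext w
    simp [hP]
  rw [← hsP ⟨x, (hP x).mp p.start_mem_support⟩, ← hsP ⟨y, (hP y).mp p.end_mem_support⟩,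
    ← blockWeight_scale S⁻¹ s hs0 p hp P (fun w hw => (hP w).mp hw)
      (hS.inv.subm _).det_pos.ne', subPathWeight, blockWeight, hempty, hinv,
    Matrix.det_isEmpty (n := (∅ : Finset V))]
  congr 2
  exact List.attach_map_val (f := fun d : G.Dart =>
    s d.toProd.1 * S⁻¹ d.toProd.1 d.toProd.2 * s d.toProd.2)

/-- correlation factorization along chordless and unique paths:
if `π` is chordless then `ω(π, Ω_{[P|P̄]}) = ρ_{xy·P̄}` and
`ω(π,Ω) = ρ_{xy·P̄} × IF_P / √(IF_x^{P̄} IF_y^{P̄})`; if moreover `π` is the unique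
path between `x` and `y` then `ω(π,Ω) = ρ_xy`, so that
`ρ_xy = ρ_{xy·P̄} × IF_P / √(IF_x^{P̄} IF_y^{P̄})`. -/
theorem correlation_chordless_unique_path {V : Type*} [Fintype V] [DecidableEq V]
    (S : Matrix V V ℝ) (hS : S.PosDef) (G : SimpleGraph V) [DecidableRel G.Adj]
    (hadapt : Adapted S⁻¹ G) {x y : V} (hxy : x ≠ y) (p : G.Walk x y) (hp : p.IsPath)
    (hchordless : Chordless p) :
    subPathWeight (corrScale (pcov S p.support.toFinset)) p
        (fun v hv => List.mem_toFinset.mpr hv) =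
      corrScale (pcov S p.support.toFinset)
        ⟨x, List.mem_toFinset.mpr p.start_mem_support⟩
        ⟨y, List.mem_toFinset.mpr p.end_mem_support⟩ ∧
    pathWeight (corrScale S) p =
      corrScale (pcov S p.support.toFinset)
          ⟨x, List.mem_toFinset.mpr p.start_mem_support⟩
          ⟨y, List.mem_toFinset.mpr p.end_mem_support⟩ *
        (inflF S p.support.toFinset p.support.toFinsetᶜ /
          Real.sqrt (inflF S {x} p.support.toFinsetᶜ * inflF S {y} p.support.toFinsetᶜ)) ∧
    ((∀ q : G.Walk x y, q.IsPath → q = p) →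
      pathWeight (corrScale S) p = corrScale S x y ∧
      corrScale S x y =
        corrScale (pcov S p.support.toFinset)
            ⟨x, List.mem_toFinset.mpr p.start_mem_support⟩
            ⟨y, List.mem_toFinset.mpr p.end_mem_support⟩ *
          (inflF S p.support.toFinset p.support.toFinsetᶜ /
            Real.sqrt (inflF S {x} p.support.toFinsetᶜ * inflF S {y} p.support.toFinsetᶜ))) := by
  have hpos : ∀ A : Finset V, (subm S⁻¹ A A).det ≠ 0 := fun A => (hS.inv.subm A).det_pos.ne'
  have hsymm : ∀ i j, S⁻¹ i j = S⁻¹ j i := fun i j => by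
    simpa using (hS.inv.isHermitian.apply i j).symm
  set P := p.support.toFinset with hP
  have hmem : ∀ v, v ∈ p.support ↔ v ∈ P := fun v => List.mem_toFinset.symm
  set x' : P := ⟨x, List.mem_toFinset.mpr p.start_mem_support⟩ with hx'
  set y' : P := ⟨y, List.mem_toFinset.mpr p.end_mem_support⟩ with hy'
  have hpcov : blockWeight S⁻¹ P p = pcov S P x' y' := by
    rw [blockWeight_eq_inv_apply hadapt hsymm hpos p hp P (fun w hw => (hmem w).mp hw)
      (fun q hq hqP => hchordless.eq_of_support_subset hp q hq fun w hw => (hmem w).mpr (hqP w hw)),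
      pcov_eq_inv hS]
    exact inv_blockMask_apply S⁻¹ P (hpos P) x' y'
  have hPD : (pcov S P).PosDef := by
    rw [pcov_eq_inv hS]
    exact (hS.inv.subm P).inv
  have hpath := pathWeight_corrScale hS p hp
  have hmain : pathWeight (corrScale S) p = corrScale (pcov S P) x' y' *
      (inflF S P Pᶜ / √(inflF S {x} Pᶜ * inflF S {y} Pᶜ)) := by
    have hratio : blockWeight S⁻¹ Finset.univ p = blockWeight S⁻¹ P p * inflF S P Pᶜ := by
      rw [inflF_compl hS, blockWeight, blockWeight, ← hP, Finset.sdiff_self, det_subm_univ,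
        Matrix.det_isEmpty (n := (∅ : Finset V)), Finset.compl_eq_univ_sdiff]
      have := hpos P
      field_simp
    have hx : inflF S {x} Pᶜ = S x x / pcov S P x' x' := inflF_singleton_compl hS x'
    have hy : inflF S {y} Pᶜ = S y y / pcov S P y' y' := inflF_singleton_compl hS y'
    have hSx : 0 < S x x := hS.diag_pos
    have hSy : 0 < S y y := hS.diag_pos
    have hpx : 0 < pcov S P x' x' := hPD.diag_pos
    have hpy : 0 < pcov S P y' y' := hPD.diag_pos
    rw [hpath, hratio, hpcov, hx, hy, Real.sqrt_mul (div_pos hSx hpx).le, Real.sqrt_div hSx.le,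
      Real.sqrt_div hSy.le, corrScale, Matrix.of_apply]
    have := Real.sqrt_pos.mpr hSx
    have := Real.sqrt_pos.mpr hSy
    have := Real.sqrt_pos.mpr hpx
    have := Real.sqrt_pos.mpr hpy
    field_simp
  refine ⟨?_, hmain, fun huniq => ?_⟩
  · rw [subPathWeight_corrScale_pcov hS p hp hmem, hpcov]
    rfl
  · have hcorr : pathWeight (corrScale S) p = corrScale S x y := by
      rw [hpath, blockWeight_eq_inv_apply hadapt hsymm hpos p hp Finset.univ
        (fun w _ => Finset.mem_univ w) (fun q hq _ => huniq q hq), blockMask_univ,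
        Matrix.nonsing_inv_nonsing_inv S hS.det_pos.ne'.isUnit]
      rfl
    exact ⟨hcorr, hcorr ▸ hmain⟩
end
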